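/- arXiv:2011.07683 — 3 statements merged into one kernel-verified Lean document; each statement's English description precedes it below -/
import Mathlib

section
/- Let ℒ be the Laplacian tensor of a weighted k-uniform hypergraph on Fin n, and define the contraction M : Matrix (Fin n) (Fin n) ℝ by M i j = Σ over tuples (i₃,…,i_k) ∈ (Fin n)^{k−2} of ℒ(i,j,i₃,…,i_k). Then M i i = d i for every i, and for every i ≠ j, M i j = −(1/(k−1))·Σ_{e ∈ E with i ∈ e and j ∈ e} w e. Hence M is exactly the graph Laplacian D − A_T of the degree-preserving clique expansion, whose adjacency matrix is A_T i j = Σ_{e ∋ i,j} w e/(k−1) for i ≠ j and 0 on the diagonal. -/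
open Finset

/-- Degree of vertex `i` in a weighted hypergraph `(E, w)`. -/
noncomputable def deg {n : ℕ} (E : Finset (Finset (Fin n))) (w : Finset (Fin n) → ℝ)
    (i : Fin n) : ℝ :=
  ∑ e ∈ E.filter (fun e => i ∈ e), w e

/-- Adjacency tensor of a weighted `k`-uniform hypergraph. -/
noncomputable def adjT {n : ℕ} (E : Finset (Finset (Fin n))) (w : Finset (Fin n) → ℝ)
    (k : ℕ) (σ : Fin k → Fin n) : ℝ :=
  if Function.Injective σ ∧ Finset.image σ Finset.univ ∈ E then
    w (Finset.image σ Finset.univ) / (Nat.factorial (k - 1)) else 0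

/-- Laplacian tensor `𝒟 - 𝒜`. -/
noncomputable def lapT {n : ℕ} (E : Finset (Finset (Fin n))) (w : Finset (Fin n) → ℝ)
    (k : ℕ) (σ : Fin k → Fin n) : ℝ :=
  (∑ i : Fin n, if σ = Function.const (Fin k) i then deg E w i else 0) - adjT E w k σ

/-- The tuple `(i, τ₁, …, τ_{k-1})`. -/
def consT {n : ℕ} (k : ℕ) (i : Fin n) (τ : Fin (k - 1) → Fin n) : Fin k → Fin n :=
  fun t => if ht : t.val = 0 then i else τ ⟨t.val - 1, by have := t.isLt; omega⟩

/-- The Laplacian form `ℒ x^k`. -/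
noncomputable def lapForm {n : ℕ} (E : Finset (Finset (Fin n))) (w : Finset (Fin n) → ℝ)
    (k : ℕ) (x : Fin n → ℝ) : ℝ :=
  ∑ σ : Fin k → Fin n, lapT E w k σ * ∏ t, x (σ t)

/-- The tuple `(i, j, τ₁, …, τ_{k-2})`. -/
def cons2T {n : ℕ} (k : ℕ) (i j : Fin n) (τ : Fin (k - 2) → Fin n) : Fin k → Fin n :=
  fun t =>
    if ht0 : t.val = 0 then i
    else if ht1 : t.val = 1 then j
    else τ ⟨t.val - 2, by have := t.isLt; omega⟩

/-- The injective enumerations of an `m`-element set number `m!`. -/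
theorem card_injective_image_eq {α : Type*} [Fintype α] [DecidableEq α] {m : ℕ} (s : Finset α)
    (hs : s.card = m) :
    (univ.filter fun τ : Fin m → α => Function.Injective τ ∧ univ.image τ = s).card
      = m.factorial := by
  have h : (univ.filter fun τ : Fin m → α => Function.Injective τ ∧ univ.image τ = s)
      = (univ : Finset (Fin m ↪ s)).image fun f t => (f t : α) := by
    ext τ
    simp only [mem_filter, mem_univ, true_and, mem_image]
    constructor
    · rintro ⟨hinj, rfl⟩
      exact ⟨⟨fun t => ⟨τ t, mem_image_of_mem _ (mem_univ t)⟩,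
        fun a b hab => hinj (congrArg Subtype.val hab)⟩, rfl⟩
    · rintro ⟨f, rfl⟩
      have hinj : Function.Injective fun t => (f t : α) :=
        Subtype.val_injective.comp f.injective
      refine ⟨hinj, eq_of_subset_of_card_le ?_ ?_⟩
      · intro a ha
        obtain ⟨t, -, rfl⟩ := mem_image.mp ha
        exact (f t).2
      · rw [card_image_of_injective _ hinj, card_univ, Fintype.card_fin, hs]
  rw [h, card_image_of_injective, card_univ, Fintype.card_embedding_eq]
  · simp [hs, Nat.descFactorial_self]
  · intro f g hfg
    ext t
    exact congrFun hfg t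

theorem cons2T_eq_cons {n m : ℕ} (i j : Fin n) (τ : Fin m → Fin n) :
    cons2T (m + 2) i j τ
      = (Fin.cons i (Fin.cons j τ : Fin (m + 1) → Fin n) : Fin (m + 2) → Fin n) := by
  funext t
  refine Fin.cases rfl (fun t => Fin.cases rfl (fun t => ?_) t) t
  simp only [cons2T, Fin.cons_succ, Fin.val_succ]
  rfl

theorem cons2T_eq_const_iff {n m : ℕ} (i j a : Fin n) (τ : Fin m → Fin n) :
    cons2T (m + 2) i j τ = Function.const (Fin (m + 2)) a
      ↔ i = a ∧ j = a ∧ τ = Function.const (Fin m) a := by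
  rw [cons2T_eq_cons]
  simp [funext_iff, Fin.forall_fin_succ]

theorem cons2T_injective_and_image_eq_iff {n m : ℕ} {i j : Fin n} (hij : i ≠ j)
    (e : Finset (Fin n)) (τ : Fin m → Fin n) :
    (Function.Injective (cons2T (m + 2) i j τ) ∧ univ.image (cons2T (m + 2) i j τ) = e)
      ↔ (i ∈ e ∧ j ∈ e) ∧ Function.Injective τ ∧ univ.image τ = (e.erase i).erase j := by
  have him : univ.image (cons2T (m + 2) i j τ) = insert i (insert j (univ.image τ)) := by
    rw [cons2T_eq_cons]
    ext a
    simp [Fin.exists_fin_succ, eq_comm]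
  have hinj : Function.Injective (cons2T (m + 2) i j τ)
      ↔ i ∉ univ.image τ ∧ j ∉ univ.image τ ∧ Function.Injective τ := by
    rw [cons2T_eq_cons, Fin.cons_injective_iff, Fin.cons_injective_iff]
    simp only [Fin.range_cons, Set.mem_insert_iff, hij, false_or, mem_image_univ_iff_mem_range]
  rw [him, hinj]
  constructor
  · rintro ⟨⟨hi, hj, hτ⟩, rfl⟩
    refine ⟨by simp, hτ, ?_⟩
    rw [erase_insert (by rwa [mem_insert, or_iff_right hij]), erase_insert hj]
  · rintro ⟨⟨hi, hj⟩, hτ, h⟩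
    rw [h]
    refine ⟨⟨by simp, by simp, hτ⟩, ?_⟩
    rw [insert_erase (mem_erase.mpr ⟨hij.symm, hj⟩), insert_erase hi]

theorem sum_diagonal_cons2T {n m : ℕ} (d : Fin n → ℝ) (i j : Fin n) :
    (∑ τ : Fin m → Fin n, ∑ a : Fin n,
      if cons2T (m + 2) i j τ = Function.const (Fin (m + 2)) a then d a else 0)
      = if i = j then d i else 0 := by
  rw [sum_comm]
  simp only [cons2T_eq_const_iff, ite_and, sum_ite_irrel, sum_const_zero, sum_ite_eq', mem_univ,
    if_true, sum_ite_eq]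
  simp only [eq_comm]

theorem sum_adjT_cons2T_self {n m : ℕ} (E : Finset (Finset (Fin n))) (w : Finset (Fin n) → ℝ)
    (i : Fin n) : ∑ τ : Fin m → Fin n, adjT E w (m + 2) (cons2T (m + 2) i i τ) = 0 := by
  refine sum_eq_zero fun τ _ => if_neg ?_
  rintro ⟨h, -⟩
  have h01 : (0 : Fin (m + 2)) = 1 := h rfl
  simp at h01

theorem sum_adjT_cons2T_of_ne {n m : ℕ} (E : Finset (Finset (Fin n))) (w : Finset (Fin n) → ℝ)
    (hcard : ∀ e ∈ E, e.card = m + 2) {i j : Fin n} (hij : i ≠ j) :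
    ∑ τ : Fin m → Fin n, adjT E w (m + 2) (cons2T (m + 2) i j τ)
      = (∑ e ∈ E.filter (fun e => i ∈ e ∧ j ∈ e), w e) / ((m : ℝ) + 1) := by
  have hadj (σ : Fin (m + 2) → Fin n) : adjT E w (m + 2) σ
      = ∑ e ∈ E, if Function.Injective σ ∧ univ.image σ = e
          then w e / ((m + 1).factorial : ℝ) else 0 := by
    simp only [adjT, ite_and, sum_ite_irrel, sum_const_zero, sum_ite_eq]
    rfl
  simp only [hadj]
  rw [sum_comm, sum_filter, sum_div]
  refine sum_congr rfl fun e he => ?_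
  simp only [cons2T_injective_and_image_eq_iff hij]
  by_cases h : i ∈ e ∧ j ∈ e
  · have hc : ((e.erase i).erase j).card = m := by
      rw [card_erase_of_mem (mem_erase.mpr ⟨hij.symm, h.2⟩), card_erase_of_mem h.1, hcard e he]
      omega
    simp only [h, true_and, if_true, and_self]
    rw [← sum_filter, sum_const, card_injective_image_eq _ hc, nsmul_eq_mul, Nat.factorial_succ]
    have := Nat.factorial_ne_zero m
    push_cast
    field_simp
  · simp [h]

/-- the `(k-2)`-fold contraction of the Laplacian tensor against the all-ones
vector is exactly the graph Laplacian of the degree-preserving clique expansion. -/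
theorem lap_contraction_degree_preserving_clique
    (n k : ℕ) (hn : 1 ≤ n) (hk : 2 ≤ k)
    (E : Finset (Finset (Fin n))) (w : Finset (Fin n) → ℝ)
    (hcard : ∀ e ∈ E, e.card = k) (hw : ∀ e ∈ E, 0 < w e)
    (M : Matrix (Fin n) (Fin n) ℝ)
    (hM : ∀ i j, M i j = ∑ τ : Fin (k - 2) → Fin n, lapT E w k (cons2T k i j τ)) :
    (∀ i, M i i = deg E w i) ∧
    (∀ i j, i ≠ j →
      M i j = -(1 / ((k : ℝ) - 1)) * ∑ e ∈ E.filter (fun e => i ∈ e ∧ j ∈ e), w e) ∧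
    (M = Matrix.of fun i j =>
      (if i = j then deg E w i else 0) -
      (if i = j then 0 else (∑ e ∈ E.filter (fun e => i ∈ e ∧ j ∈ e), w e) / ((k : ℝ) - 1))) := by
  obtain ⟨m, rfl⟩ := Nat.exists_eq_add_of_le' hk
  have hk' : ((m + 2 : ℕ) : ℝ) - 1 = m + 1 := by push_cast; ring
  have hM' (i j : Fin n) : M i j = (if i = j then deg E w i else 0)
      - ∑ τ : Fin m → Fin n, adjT E w (m + 2) (cons2T (m + 2) i j τ) := by
    rw [hM, ← sum_diagonal_cons2T (m := m), ← sum_sub_distrib]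
    rfl
  have hdiag (i : Fin n) : M i i = deg E w i := by
    rw [hM', sum_adjT_cons2T_self, if_pos rfl, sub_zero]
  have hoff (i j : Fin n) (hij : i ≠ j) : M i j
      = -((∑ e ∈ E.filter (fun e => i ∈ e ∧ j ∈ e), w e) / ((m : ℝ) + 1)) := by
    rw [hM', sum_adjT_cons2T_of_ne E w hcard hij, if_neg hij, zero_sub]
  rw [hk']
  refine ⟨hdiag, fun i j hij => ?_, ?_⟩
  · rw [hoff i j hij]
    ring
  · ext i j
    rw [Matrix.of_apply]
    by_cases hij : i = j
    · subst hij
      simp [hdiag]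
    · simp [hij, hoff i j hij]
end

section
/- Let ℒ be the Laplacian tensor of a weighted k-uniform hypergraph on Fin n and x : Fin n → ℝ. For each hyperedge e ∈ E let n_s(e) = card {i ∈ e : x i < 0}. Then ℒ x^k = Σ_{e ∈ E} k · w e · ( AM_e − (−1)^{n_s(e)} · GM_e ), where AM_e = (1/k)·Σ_{i ∈ e} (x i)^k is the arithmetic mean of the values (x i)^k over i ∈ e and GM_e = ( ∏_{i ∈ e} |x i|^k )^{1/k} is the geometric mean of the values |x i|^k over i ∈ e (real power with exponent 1/k). -/
open Finset

/-- A `k`-element set has `k!` enumerations by `Fin k`. -/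
theorem card_filter_injective_image_eq {n k : ℕ} (e : Finset (Fin n)) (he : e.card = k) :
    (univ.filter fun σ : Fin k → Fin n =>
      Function.Injective σ ∧ image σ univ = e).card = k.factorial := by
  have hcard : (univ : Finset (Equiv.Perm (Fin k))).card = k.factorial := by
    rw [card_univ, Fintype.card_perm, Fintype.card_fin]
  rw [← hcard]
  symm
  refine card_bij (fun π _ => e.orderEmbOfFin he ∘ π) ?_ ?_ ?_
  · intro π _
    refine mem_filter.2 ⟨mem_univ _, (e.orderEmbOfFin he).injective.comp π.injective, ?_⟩
    apply coe_injective
    rw [coe_image, coe_univ, Set.image_univ, π.surjective.range_comp, range_orderEmbOfFin]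
  · intro π _ ρ _ h
    exact Equiv.ext fun t => (e.orderEmbOfFin he).injective (congrFun h t)
  · intro σ hσ
    obtain ⟨hinj, himg⟩ := (mem_filter.1 hσ).2
    have hmem : ∀ t, ∃ s, e.orderEmbOfFin he s = σ t := fun t => by
      rw [← Set.mem_range, range_orderEmbOfFin, mem_coe, ← himg]
      exact mem_image_of_mem σ (mem_univ t)
    choose π hπ using hmem
    have hπinj : Function.Injective π := fun a b hab => hinj (by rw [← hπ a, ← hπ b, hab])
    exact ⟨Equiv.ofBijective π hπinj.bijective_of_finite, mem_univ _, funext hπ⟩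

/-- The form of the adjacency tensor is a weighted sum of edge monomials. -/
theorem sum_adjT_mul_prod {n k : ℕ} (hk : k ≠ 0) (E : Finset (Finset (Fin n)))
    (w : Finset (Fin n) → ℝ) (hcard : ∀ e ∈ E, e.card = k) (x : Fin n → ℝ) :
    ∑ σ : Fin k → Fin n, adjT E w k σ * ∏ t, x (σ t) =
      ∑ e ∈ E, (k : ℝ) * w e * ∏ i ∈ e, x i := by
  have hterm : ∀ σ : Fin k → Fin n, adjT E w k σ * ∏ t, x (σ t) =
      ∑ e ∈ E, if Function.Injective σ ∧ image σ univ = e then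
        w e / (k - 1).factorial * ∏ i ∈ e, x i else 0 := by
    intro σ
    by_cases hσ : Function.Injective σ
    · simp only [adjT, hσ, true_and, sum_ite_eq, ite_mul, zero_mul]
      rw [prod_image hσ.injOn]
    · simp [adjT, hσ]
  rw [sum_congr rfl fun σ _ => hterm σ, sum_comm]
  refine sum_congr rfl fun e he => ?_
  rw [← sum_filter, sum_const, card_filter_injective_image_eq e (hcard e he), nsmul_eq_mul,
    ← Nat.mul_factorial_pred hk]
  have := Nat.factorial_ne_zero (k - 1)
  push_cast
  field_simp

/-- The form of the degree tensor is a weighted sum of edge power sums. -/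
theorem sum_deg_mul_prod {n k : ℕ} (E : Finset (Finset (Fin n)))
    (w : Finset (Fin n) → ℝ) (x : Fin n → ℝ) :
    ∑ σ : Fin k → Fin n,
        (∑ i : Fin n, if σ = Function.const (Fin k) i then deg E w i else 0) * ∏ t, x (σ t) =
      ∑ e ∈ E, w e * ∑ i ∈ e, x i ^ k := by
  have hdiag : ∑ σ : Fin k → Fin n,
      (∑ i : Fin n, if σ = Function.const (Fin k) i then deg E w i else 0) * ∏ t, x (σ t) =
        ∑ i, deg E w i * x i ^ k := by
    simp_rw [sum_mul, ite_mul, zero_mul]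
    rw [sum_comm]
    simp
  rw [hdiag]
  simp_rw [deg, sum_filter, sum_mul, mul_sum, ite_mul, zero_mul]
  rw [sum_comm]
  simp

/-- A product of reals is the product of absolute values up to the parity of negative factors. -/
theorem neg_one_pow_card_neg_mul_prod_abs {ι : Type*} (s : Finset ι) (x : ι → ℝ) :
    (-1 : ℝ) ^ (s.filter fun i => x i < 0).card * ∏ i ∈ s, |x i| = ∏ i ∈ s, x i := by
  rw [← prod_const, prod_filter, ← prod_mul_distrib]
  refine prod_congr rfl fun i _ => ?_
  split_ifs with h
  · rw [abs_of_neg h]; ring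
  · rw [abs_of_nonneg (not_lt.1 h), one_mul]

/-- AM–GM decomposition of the Laplacian form. -/
theorem lapForm_eq_am_gm
    (n k : ℕ) (hn : 1 ≤ n) (hk : 2 ≤ k)
    (E : Finset (Finset (Fin n))) (w : Finset (Fin n) → ℝ)
    (hcard : ∀ e ∈ E, e.card = k) (hw : ∀ e ∈ E, 0 < w e)
    (x : Fin n → ℝ) :
    lapForm E w k x =
      ∑ e ∈ E, (k : ℝ) * w e *
        ((1 / (k : ℝ)) * ∑ i ∈ e, x i ^ k -
          (-1 : ℝ) ^ ((e.filter (fun i => x i < 0)).card) *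
            (∏ i ∈ e, |x i| ^ k) ^ ((1 : ℝ) / k)) := by
  have hk0 : k ≠ 0 := by omega
  have hform : lapForm E w k x =
      ∑ e ∈ E, w e * ∑ i ∈ e, x i ^ k - ∑ e ∈ E, (k : ℝ) * w e * ∏ i ∈ e, x i := by
    rw [← sum_deg_mul_prod E w x, ← sum_adjT_mul_prod hk0 E w hcard x, ← sum_sub_distrib]
    exact sum_congr rfl fun σ _ => sub_mul _ _ _
  rw [hform, ← sum_sub_distrib]
  refine sum_congr rfl fun e _ => ?_
  rw [prod_pow, one_div, Real.pow_rpow_inv_natCast (prod_nonneg fun i _ => abs_nonneg _) hk0,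
    neg_one_pow_card_neg_mul_prod_abs]
  field_simp
end

section
/- Let k be even, and let 𝓛 be the normalized Laplacian tensor of a weighted k-uniform hypergraph on Fin n in which every vertex has positive degree. Let C be a Finset of Fin n, set ω = (Σ_{i} (d i)^{2/k})^{1/2} (real powers), and define x : Fin n → ℝ by x i = (d i)^{1/k}/ω if i ∈ C and x i = −(d i)^{1/k}/ω otherwise. Then x is a unit vector (xᵀx = 1) and 𝓛 x^k ≤ (2k/ω^k) · Σ_{e ∈ ∂E(C)} w e, where ∂E(C) = {e ∈ E : e ∩ C ≠ ∅ and e ∩ Cᶜ ≠ ∅}. -/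
open Finset

/-- Normalized Laplacian tensor of a weighted `k`-uniform hypergraph. -/
noncomputable def normLapT {n : ℕ} (E : Finset (Finset (Fin n))) (w : Finset (Fin n) → ℝ)
    (k : ℕ) (σ : Fin k → Fin n) : ℝ :=
  if ∃ i, σ = Function.const (Fin k) i then 1
  else if Function.Injective σ ∧ Finset.image σ Finset.univ ∈ E then
    -(w (Finset.image σ Finset.univ) / (Nat.factorial (k - 1))) *
      ∏ t, (deg E w (σ t)) ^ (-(1 : ℝ) / k)
  else 0

/-- The normalized Laplacian form `𝓛 x^k`. -/
noncomputable def normLapForm {n : ℕ} (E : Finset (Finset (Fin n))) (w : Finset (Fin n) → ℝ)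
    (k : ℕ) (x : Fin n → ℝ) : ℝ :=
  ∑ σ : Fin k → Fin n, normLapT E w k σ * ∏ t, x (σ t)

/-- A set of `k` elements is the image of exactly `k!` injective `k`-tuples. -/
theorem card_injective_image_eq_s11 {α : Type*} [Fintype α] [DecidableEq α] {k : ℕ}
    (e : Finset α) (he : e.card = k) :
    (univ.filter fun σ : Fin k → α => Function.Injective σ ∧ image σ univ = e).card
      = k.factorial := by
  have hcard : (univ : Finset (Fin k ↪ e)).card = k.factorial := by
    rw [card_univ, Fintype.card_embedding_eq, Fintype.card_coe, Fintype.card_fin, he,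
      Nat.descFactorial_self]
  rw [← hcard]
  symm
  refine card_bij (fun f _ t => (f t : α)) ?_ ?_ ?_
  · intro f _
    have hinj : Function.Injective fun t => (f t : α) :=
      Subtype.val_injective.comp f.injective
    refine mem_filter.2 ⟨mem_univ _, hinj, eq_of_subset_of_card_le ?_ ?_⟩
    · exact image_subset_iff.2 fun t _ => (f t).2
    · rw [card_image_of_injective _ hinj, card_univ, Fintype.card_fin, he]
  · intro f _ g _ hfg
    ext t
    exact congrFun hfg t
  · intro σ hσ
    obtain ⟨-, hinj, himg⟩ := mem_filter.1 hσ
    exact ⟨⟨fun t => ⟨σ t, himg ▸ mem_image_of_mem σ (mem_univ t)⟩,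
      fun a b hab => hinj (Subtype.ext_iff.1 hab)⟩, mem_univ _, rfl⟩

theorem sum_injective_image_mem {α : Type*} [Fintype α] [DecidableEq α] {k : ℕ}
    (E : Finset (Finset α)) (hcard : ∀ e ∈ E, e.card = k) (f : Finset α → ℝ) :
    ∑ σ : Fin k → α,
        (if Function.Injective σ ∧ image σ univ ∈ E then f (image σ univ) else 0)
      = k.factorial * ∑ e ∈ E, f e := by
  rw [← sum_filter, ← sum_fiberwise_of_maps_to
    (g := fun σ : Fin k → α => image σ univ) (t := E) (fun σ hσ => (mem_filter.1 hσ).2.2),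
    mul_sum]
  refine sum_congr rfl fun e he => ?_
  have hfilter : ((univ.filter fun σ : Fin k → α =>
      Function.Injective σ ∧ image σ univ ∈ E).filter fun σ => image σ univ = e)
      = univ.filter fun σ : Fin k → α => Function.Injective σ ∧ image σ univ = e := by
    ext σ
    simp only [mem_filter, mem_univ, true_and]
    constructor
    · rintro ⟨⟨hinj, -⟩, himg⟩
      exact ⟨hinj, himg⟩
    · rintro ⟨hinj, himg⟩
      exact ⟨⟨hinj, himg ▸ he⟩, himg⟩
  rw [hfilter, sum_congr rfl (g := fun _ => f e)
    (fun σ hσ => by rw [(mem_filter.1 hσ).2.2]), sum_const,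
    card_injective_image_eq_s11 e (hcard e he), nsmul_eq_mul]

theorem sum_const_tuple {α : Type*} [Fintype α] {k : ℕ} (hk : k ≠ 0)
    (x : α → ℝ) [DecidablePred fun σ : Fin k → α => ∃ i, σ = Function.const (Fin k) i] :
    ∑ σ : Fin k → α, (if ∃ i, σ = Function.const (Fin k) i then ∏ t, x (σ t) else 0)
      = ∑ i, x i ^ k := by
  rw [← sum_filter]
  symm
  refine sum_bij (fun i _ => Function.const (Fin k) i) ?_ ?_ ?_ ?_
  · exact fun i _ => mem_filter.2 ⟨mem_univ _, i, rfl⟩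
  · exact fun i _ j _ hij => congrFun hij ⟨0, Nat.pos_of_ne_zero hk⟩
  · intro σ hσ
    obtain ⟨-, i, rfl⟩ := mem_filter.1 hσ
    exact ⟨i, mem_univ _, rfl⟩
  · intro i _
    simp

theorem normLapForm_eq {n k : ℕ} (hk : 2 ≤ k) (E : Finset (Finset (Fin n)))
    (w : Finset (Fin n) → ℝ) (hcard : ∀ e ∈ E, e.card = k) (x : Fin n → ℝ) :
    normLapForm E w k x = ∑ i, x i ^ k
      - k * ∑ e ∈ E, w e * ∏ i ∈ e, (deg E w i ^ (-(1 : ℝ) / k) * x i) := by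
  have hfact : (k.factorial : ℝ) = k * (k - 1).factorial := by
    exact_mod_cast (Nat.mul_factorial_pred (by omega)).symm
  have hsum : (k : ℝ) * ∑ e ∈ E, w e * ∏ i ∈ e, (deg E w i ^ (-(1 : ℝ) / k) * x i)
      = k.factorial * ∑ e ∈ E, w e / (k - 1).factorial *
        ∏ i ∈ e, (deg E w i ^ (-(1 : ℝ) / k) * x i) := by
    rw [hfact, mul_assoc, mul_sum _ _ ((k - 1).factorial : ℝ)]
    congr 1
    refine sum_congr rfl fun e _ => ?_
    field_simp
  rw [hsum, ← sum_injective_image_mem E hcard, ← sum_const_tuple (by omega) x,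
    ← sum_sub_distrib, normLapForm]
  refine sum_congr rfl fun σ _ => ?_
  unfold normLapT
  by_cases hconst : ∃ i, σ = Function.const (Fin k) i
  · have hninj : ¬ (Function.Injective σ ∧ image σ univ ∈ E) := by
      rintro ⟨hinj, -⟩
      obtain ⟨i, rfl⟩ := hconst
      have h01 := @hinj ⟨0, by omega⟩ ⟨1, by omega⟩ rfl
      simp at h01
    simp only [if_pos hconst, if_neg hninj, one_mul, sub_zero]
  · by_cases hinj : Function.Injective σ ∧ image σ univ ∈ E
    · simp only [if_neg hconst, if_pos hinj]
      rw [prod_image fun a _ b _ hab => hinj.1 hab, prod_mul_distrib]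
      ring
    · simp only [if_neg hconst, if_neg hinj]
      ring

theorem sum_deg {n k : ℕ} (E : Finset (Finset (Fin n))) (w : Finset (Fin n) → ℝ)
    (hcard : ∀ e ∈ E, e.card = k) : ∑ i, deg E w i = k * ∑ e ∈ E, w e := by
  simp only [deg, sum_filter]
  rw [sum_comm, mul_sum]
  refine sum_congr rfl fun e he => ?_
  rw [← sum_filter, filter_univ_mem, sum_const, hcard e he, nsmul_eq_mul]

/-- The `±1`-valued indicator of `C`. -/
noncomputable def cutSign {n : ℕ} (C : Finset (Fin n)) (i : Fin n) : ℝ :=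
  if i ∈ C then 1 else -1

theorem abs_cutSign {n : ℕ} (C : Finset (Fin n)) (i : Fin n) : |cutSign C i| = 1 := by
  unfold cutSign
  split_ifs <;> simp

theorem one_sub_prod_cutSign_le {n : ℕ} (C e : Finset (Fin n)) (he : Even e.card) :
    1 - ∏ i ∈ e, cutSign C i
      ≤ if (e ∩ C).Nonempty ∧ (e ∩ Cᶜ).Nonempty then 2 else 0 := by
  split_ifs with h
  · have habs : |∏ i ∈ e, cutSign C i| = 1 := by
      rw [abs_prod]
      exact prod_eq_one fun i _ => abs_cutSign C i
    linarith [neg_abs_le (∏ i ∈ e, cutSign C i)]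
  · suffices ∏ i ∈ e, cutSign C i = 1 by rw [this, sub_self]
    rw [not_and_or, not_nonempty_iff_eq_empty, not_nonempty_iff_eq_empty] at h
    rcases h with h | h
    · rw [prod_congr rfl (g := fun _ => (-1 : ℝ)), prod_const, he.neg_one_pow]
      intro i hi
      exact if_neg fun hC => notMem_empty i (h ▸ mem_inter.2 ⟨hi, hC⟩)
    · refine prod_eq_one fun i hi => if_pos ?_
      by_contra hC
      exact notMem_empty i (h ▸ mem_inter.2 ⟨hi, mem_compl.2 hC⟩)

/-- the test vector built from a vertex subset `C` is a unit vector whose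
normalized Laplacian form is at most `(2k/ω^k)` times the boundary weight of `C`. -/
theorem normLapForm_test_vector_bound
    (n k : ℕ) (hn : 1 ≤ n) (hk : 2 ≤ k) (hkeven : Even k)
    (E : Finset (Finset (Fin n))) (w : Finset (Fin n) → ℝ)
    (hcard : ∀ e ∈ E, e.card = k) (hw : ∀ e ∈ E, 0 < w e)
    (hd : ∀ i, 0 < deg E w i)
    (C : Finset (Fin n))
    (ω : ℝ) (hω : ω = (∑ i, (deg E w i) ^ ((2 : ℝ) / k)) ^ ((1 : ℝ) / 2))
    (x : Fin n → ℝ)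
    (hx : ∀ i, x i =
      if i ∈ C then (deg E w i) ^ ((1 : ℝ) / k) / ω
      else -((deg E w i) ^ ((1 : ℝ) / k) / ω)) :
    (∑ i, x i * x i = 1) ∧
    normLapForm E w k x ≤
      (2 * k / ω ^ k) *
        ∑ e ∈ E.filter (fun e => (e ∩ C).Nonempty ∧ (e ∩ Cᶜ).Nonempty), w e := by
  have hkpos : (0 : ℝ) < k := by exact_mod_cast (by omega : 0 < k)
  have hsum_pos : 0 < ∑ i, deg E w i ^ ((2 : ℝ) / k) :=
    sum_pos (fun i _ => Real.rpow_pos_of_pos (hd i) _) ⟨⟨0, hn⟩, mem_univ _⟩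
  have hω_pos : 0 < ω := hω ▸ Real.rpow_pos_of_pos hsum_pos _
  have hω_sq : ω * ω = ∑ i, deg E w i ^ ((2 : ℝ) / k) := by
    rw [hω, ← Real.sqrt_eq_rpow, Real.mul_self_sqrt hsum_pos.le]
  have hx_eq (i) : x i = cutSign C i * (deg E w i ^ ((1 : ℝ) / k) / ω) := by
    rw [hx, cutSign]
    split_ifs <;> ring
  have hsq (i) : cutSign C i * cutSign C i = 1 := by
    rw [← abs_mul_abs_self, abs_cutSign, one_mul]
  refine ⟨?_, ?_⟩
  · have hterm (i) : x i * x i = deg E w i ^ ((2 : ℝ) / k) / (ω * ω) := by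
      have hpow : deg E w i ^ ((2 : ℝ) / k)
          = deg E w i ^ ((1 : ℝ) / k) * deg E w i ^ ((1 : ℝ) / k) := by
        rw [← Real.rpow_add (hd i)]
        ring_nf
      rw [hx_eq, mul_mul_mul_comm, hsq, one_mul, div_mul_div_comm, hpow]
    simp only [hterm]
    rw [← sum_div, ← hω_sq, div_self (by positivity)]
  · have hpow (i) : x i ^ k = deg E w i / ω ^ k := by
      rw [hx_eq, mul_pow, div_pow, ← hkeven.pow_abs (cutSign C i), abs_cutSign, one_pow, one_mul,
        ← Real.rpow_natCast (deg E w i ^ ((1 : ℝ) / k)), ← Real.rpow_mul (hd i).le,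
        one_div_mul_cancel hkpos.ne', Real.rpow_one]
    have hscale (i) : deg E w i ^ (-(1 : ℝ) / k) * x i = cutSign C i / ω := by
      have hinv : deg E w i ^ (-(1 : ℝ) / k) * deg E w i ^ ((1 : ℝ) / k) = 1 := by
        rw [← Real.rpow_add (hd i), neg_div, neg_add_cancel, Real.rpow_zero]
      rw [hx_eq]
      linear_combination cutSign C i / ω * hinv
    have hprod : ∀ e ∈ E, w e * ∏ i ∈ e, (deg E w i ^ (-(1 : ℝ) / k) * x i)
        = w e * (∏ i ∈ e, cutSign C i) / ω ^ k := fun e he => by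
      simp only [hscale]
      rw [prod_div_distrib, prod_const, hcard e he, mul_div_assoc]
    have hform : normLapForm E w k x
        = k / ω ^ k * ∑ e ∈ E, w e * (1 - ∏ i ∈ e, cutSign C i) := by
      rw [normLapForm_eq hk E w hcard, sum_congr rfl hprod, ← sum_div]
      simp only [hpow, mul_sub, mul_one]
      rw [← sum_div, sum_deg E w hcard, sum_sub_distrib]
      ring
    have hbound : ∑ e ∈ E, w e * (1 - ∏ i ∈ e, cutSign C i)
        ≤ 2 * ∑ e ∈ E.filter (fun e => (e ∩ C).Nonempty ∧ (e ∩ Cᶜ).Nonempty), w e := by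
      rw [sum_filter, mul_sum]
      refine sum_le_sum fun e he => ?_
      refine (mul_le_mul_of_nonneg_left
        (one_sub_prod_cutSign_le C e (by rwa [hcard e he])) (hw e he).le).trans_eq ?_
      split_ifs <;> ring
    calc normLapForm E w k x
        = k / ω ^ k * ∑ e ∈ E, w e * (1 - ∏ i ∈ e, cutSign C i) := hform
      _ ≤ k / ω ^ k *
          (2 * ∑ e ∈ E.filter (fun e => (e ∩ C).Nonempty ∧ (e ∩ Cᶜ).Nonempty), w e) := by
        gcongr
      _ = _ := by ring
end
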